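/- Let X ∈ R^{I_1×···×I_N} be an Nth-order tensor admitting an exact Tucker decomposition X = G ×_1 A_1 ×_2 ··· ×_N A_N with core G ∈ R^{R_1×···×R_N} full-rank in every mode (rank(G_{(n)}) = R_n), and let Φ_n ∈ R^{R_n×I_n} be sensing matrices such that each Φ_n A_n ∈ R^{R_n×R_n} is invertible. Define W = X ×_1 Φ_1 ··· ×_N Φ_N and Z_n = (X ×_1 Φ_1 ··· ×_{n-1} Φ_{n-1} ×_{n+1} Φ_{n+1} ··· ×_N Φ_N)_{(n)}. Then the reconstruction X̂ = W ×_1 Z_1 W_{(1)}^† ×_2 ··· ×_N Z_N W_{(N)}^† equals X exactly. -/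

import Mathlib

open Matrix

/-- The Kronecker product of a family of matrices, indexed by dependent functions. -/
def Matrix.piKronecker {ι : Type*} [Fintype ι] {α β : ι → Type*}
    (M : ∀ k, Matrix (α k) (β k) ℝ) : Matrix (∀ k, α k) (∀ k, β k) ℝ :=
  of fun a b => ∏ k, M k (a k) (b k)

/-- The mode-`n` unfolding of a tensor. -/
def tensorUnfold {ι : Type*} [DecidableEq ι] {α : ι → Type*} (n : ι) (T : (∀ k, α k) → ℝ) :
    Matrix (α n) (∀ k : {k : ι // k ≠ n}, α k.1) ℝ :=
  of fun a c => T ((Equiv.piSplitAt n α).symm (a, c))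

section

variable {ι : Type*} [Fintype ι] {α β γ : ι → Type*}

lemma Matrix.piKronecker_mul [DecidableEq ι] [∀ k, Fintype (β k)] (M : ∀ k, Matrix (α k) (β k) ℝ)
    (M' : ∀ k, Matrix (β k) (γ k) ℝ) :
    piKronecker M * piKronecker M' = piKronecker fun k => M k * M' k := by
  ext a c
  simp only [piKronecker, mul_apply, of_apply, Fintype.prod_sum, Finset.prod_mul_distrib]

lemma Matrix.piKronecker_one [∀ k, DecidableEq (α k)] :
    piKronecker (fun k => (1 : Matrix (α k) (α k) ℝ)) = 1 := by
  ext a b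
  simp only [piKronecker, of_apply, one_apply, Finset.prod_ite_zero, Finset.prod_const_one,
    funext_iff, Finset.mem_univ, true_imp_iff]

variable [DecidableEq ι]

lemma tensorUnfold_piKronecker_mulVec [∀ k, Fintype (β k)] (n : ι)
    (M : ∀ k, Matrix (α k) (β k) ℝ) (T : (∀ k, β k) → ℝ) :
    tensorUnfold n (piKronecker M *ᵥ T) = M n * tensorUnfold n T *
      (piKronecker fun k : {k : ι // k ≠ n} => M k.1)ᵀ := by
  ext a c
  simp only [tensorUnfold, piKronecker, mulVec, dotProduct, mul_apply, of_apply, transpose_apply,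
    Finset.sum_mul]
  rw [← (Equiv.piSplitAt n β).symm.sum_comp, Fintype.sum_prod_type, Finset.sum_comm]
  refine Finset.sum_congr rfl fun d _ => Finset.sum_congr rfl fun b _ => ?_
  rw [Fintype.prod_eq_mul_prod_subtype_ne _ n]
  have h : ∀ k : {k : ι // k ≠ n}, M k.1 ((Equiv.piSplitAt n α).symm (a, c) k.1)
      ((Equiv.piSplitAt n β).symm (b, d) k.1) = M k.1 (c k) (d k) := fun k => by
    simp [Equiv.piSplitAt, k.2]
  simp only [h]
  simp [Equiv.piSplitAt]
  ring

lemma tensorUnfold_mul_piKronecker_transpose_apply [∀ k, Fintype (β k)] [∀ k, DecidableEq (β k)]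
    (n : ι) (M : ∀ k : {k : ι // k ≠ n}, Matrix (α k.1) (β k.1) ℝ) (T : (∀ k, β k) → ℝ)
    (a : β n) (c : ∀ k : {k : ι // k ≠ n}, α k.1) :
    (tensorUnfold n T * (piKronecker M)ᵀ) a c =
      ∑ i, if i n = a then T i * ∏ k : {k : ι // k ≠ n}, M k (c k) (i k.1) else 0 := by
  rw [← (Equiv.piSplitAt n β).symm.sum_comp, Fintype.sum_prod_type, Finset.sum_comm]
  simp only [tensorUnfold, piKronecker, mul_apply, of_apply, transpose_apply]
  refine Finset.sum_congr rfl fun d _ => ?_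
  have h : ∀ b, ∀ k : {k : ι // k ≠ n}, (Equiv.piSplitAt n β).symm (b, d) k.1 = d k :=
    fun b k => by simp [Equiv.piSplitAt, k.2]
  have h' : ∀ b, (Equiv.piSplitAt n β).symm (b, d) n = b := fun b => by simp [Equiv.piSplitAt]
  simp only [h, h', Finset.sum_ite_eq', Finset.mem_univ, if_true]

end

lemma Matrix.exists_mul_eq_one_of_rank_eq {m n : Type*} [Fintype m] [Fintype n] [DecidableEq m]
    (M : Matrix m n ℝ) (h : M.rank = Fintype.card m) : ∃ M' : Matrix n m ℝ, M * M' = 1 := by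
  classical
  refine mulVec_surjective_iff_exists_right_inverse.mp ?_
  have h_top : LinearMap.range M.mulVecLin = ⊤ :=
    Submodule.eq_top_of_finrank_eq (by rw [Module.finrank_fintype_fun_eq_card]; exact h)
  exact LinearMap.range_eq_top.mp h_top

lemma Matrix.mul_eq_one_of_mul_mul_eq_self {m n : Type*} [Fintype m] [Fintype n] [DecidableEq m]
    {M : Matrix m n ℝ} {P M' : Matrix n m ℝ} (h : M * P * M = M) (h' : M * M' = 1) :
    M * P = 1 := by
  rw [← h', ← h, Matrix.mul_assoc _ M M', h', Matrix.mul_one, h]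

lemma tensorUnfold_eq_of_apply {N : ℕ} {R : Fin N → ℕ} {T : (∀ k, Fin (R k)) → ℝ} {n : Fin N}
    {U : Matrix (Fin (R n)) (∀ k : {k : Fin N // k ≠ n}, Fin (R k.1)) ℝ}
    (hU : ∀ r c, U r c
      = T (fun k => if h : k = n then Fin.cast (congrArg R h).symm r else c ⟨k, h⟩)) :
    U = tensorUnfold n T := by
  ext r c
  rw [hU, tensorUnfold, of_apply]
  congr 1
  funext k
  by_cases h : k = n
  · subst h
    simp [Equiv.piSplitAt]
  · simp [Equiv.piSplitAt, h]

/-- Theorem 1 of the paper: exact recovery of an Nth-order tensor with an exact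
Tucker decomposition (full-rank core) from its multi-way measurements, via
X̂ = W ×₁ Z₁W₍₁₎† ×₂ ⋯ ×_N Z_N W₍N₎†.  Tensors are encoded as functions on product index
types; the iterated mode product is written as a multilinear contraction, and each
Moore–Penrose pseudo-inverse P n is characterized by the four Penrose conditions. -/
theorem exact_tucker_recovery (N : ℕ) (I R : Fin N → ℕ)
    (X : (∀ k, Fin (I k)) → ℝ) (G : (∀ k, Fin (R k)) → ℝ)
    (A : ∀ n, Matrix (Fin (I n)) (Fin (R n)) ℝ)
    (Φ : ∀ n, Matrix (Fin (R n)) (Fin (I n)) ℝ)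
    -- Tucker decomposition X = G ×₁ A₁ ⋯ ×_N A_N :
    (hX : ∀ i, X i = ∑ r : ∀ k, Fin (R k), G r * ∏ n, A n (i n) (r n))
    -- the core is full-rank in every mode:
    (Gu : ∀ n, Matrix (Fin (R n)) (∀ k : {k : Fin N // k ≠ n}, Fin (R k.1)) ℝ)
    (hGu : ∀ n r c, Gu n r c
      = G (fun k => if h : k = n then Fin.cast (congrArg R h).symm r else c ⟨k, h⟩))
    (hGrank : ∀ n, (Gu n).rank = R n)
    -- each Φ n A n is invertible:
    (hΦA : ∀ n, IsUnit (Φ n * A n).det)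
    -- core measurement tensor W = X ×₁ Φ₁ ⋯ ×_N Φ_N :
    (W : (∀ k, Fin (R k)) → ℝ)
    (hW : ∀ r, W r = ∑ i : ∀ k, Fin (I k), X i * ∏ n, Φ n (r n) (i n))
    -- mode-n unfoldings Z n of the multi-way measurements Z⁽ⁿ⁾ (all modes sensed except n):
    (Z : ∀ n, Matrix (Fin (I n)) (∀ k : {k : Fin N // k ≠ n}, Fin (R k.1)) ℝ)
    (hZ : ∀ n a c, Z n a c = ∑ i : ∀ k, Fin (I k),
      (if i n = a then X i * ∏ k : {k : Fin N // k ≠ n}, Φ k.1 (c k) (i k.1) else 0))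
    -- mode-n unfoldings of W :
    (Wu : ∀ n, Matrix (Fin (R n)) (∀ k : {k : Fin N // k ≠ n}, Fin (R k.1)) ℝ)
    (hWu : ∀ n r c, Wu n r c
      = W (fun k => if h : k = n then Fin.cast (congrArg R h).symm r else c ⟨k, h⟩))
    -- Moore–Penrose pseudo-inverses P n of Wu n (Penrose conditions):
    (P : ∀ n, Matrix (∀ k : {k : Fin N // k ≠ n}, Fin (R k.1)) (Fin (R n)) ℝ)
    (hP1 : ∀ n, Wu n * P n * Wu n = Wu n) (hP2 : ∀ n, P n * Wu n * P n = P n)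
    (hP3 : ∀ n, (Wu n * P n)ᵀ = Wu n * P n) (hP4 : ∀ n, (P n * Wu n)ᵀ = P n * Wu n) :
    ∀ i, X i = ∑ r : ∀ k, Fin (R k), W r * ∏ n, (Z n * P n) (i n) (r n) := by
  have hXG : X = piKronecker A *ᵥ G := funext fun i => by
    simp only [hX, piKronecker, mulVec, dotProduct, of_apply, mul_comm]
  have hWX : W = piKronecker Φ *ᵥ X := funext fun r => by
    simp only [hW, piKronecker, mulVec, dotProduct, of_apply, mul_comm]
  have hZP : ∀ n, Z n * P n = A n * (Φ n * A n)⁻¹ := fun n => by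
    set K := piKronecker fun k : {k : Fin N // k ≠ n} => Φ k.1 * A k.1 with hK
    have hKinv : K * piKronecker (fun k : {k : Fin N // k ≠ n} => (Φ k.1 * A k.1)⁻¹) = 1 := by
      simp only [hK, piKronecker_mul, mul_nonsing_inv _ (hΦA _), piKronecker_one]
    have hKT : Kᵀ * (piKronecker fun k : {k : Fin N // k ≠ n} => (Φ k.1 * A k.1)⁻¹)ᵀ = 1 := by
      rw [← transpose_mul, mul_eq_one_comm.mp hKinv, transpose_one]
    have hZ' : Z n = A n * (Gu n * Kᵀ) := by
      have hZX : Z n = tensorUnfold n X *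
          (piKronecker fun k : {k : Fin N // k ≠ n} => Φ k.1)ᵀ := by
        ext a c
        exact (hZ n a c).trans (tensorUnfold_mul_piKronecker_transpose_apply
          (α := fun k => Fin (R k)) n (fun k => Φ k.1) X a c).symm
      rw [hZX, hXG, tensorUnfold_piKronecker_mulVec, tensorUnfold_eq_of_apply (hGu n), hK,
        ← piKronecker_mul, transpose_mul]
      simp only [Matrix.mul_assoc]
    have hWu' : Wu n = Φ n * A n * (Gu n * Kᵀ) := by
      rw [tensorUnfold_eq_of_apply (hWu n), hWX, hXG, mulVec_mulVec, piKronecker_mul,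
        tensorUnfold_piKronecker_mulVec, tensorUnfold_eq_of_apply (hGu n), Matrix.mul_assoc]
    obtain ⟨G', hG'⟩ := (Gu n).exists_mul_eq_one_of_rank_eq (by simpa using hGrank n)
    have hWP : Wu n * P n = 1 := by
      refine mul_eq_one_of_mul_mul_eq_self (hP1 n)
        (M' := (piKronecker fun k : {k : Fin N // k ≠ n} => (Φ k.1 * A k.1)⁻¹)ᵀ *
          (G' * (Φ n * A n)⁻¹)) ?_
      rw [hWu', Matrix.mul_assoc, Matrix.mul_assoc (Gu n), ← Matrix.mul_assoc Kᵀ, hKT,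
        Matrix.one_mul, ← Matrix.mul_assoc (Gu n), hG', Matrix.one_mul,
        mul_nonsing_inv _ (hΦA n)]
    rw [hWu', Matrix.mul_assoc] at hWP
    rw [hZ', Matrix.mul_assoc, inv_eq_right_inv hWP]
  intro i
  have hfinal : piKronecker (fun n => Z n * P n) *ᵥ W = X := by
    rw [hWX, hXG, mulVec_mulVec, mulVec_mulVec, piKronecker_mul, piKronecker_mul]
    congr 2
    funext n
    rw [hZP, Matrix.mul_assoc, Matrix.mul_assoc, nonsing_inv_mul _ (hΦA n), Matrix.mul_one]
  rw [← congrFun hfinal i]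
  simp only [piKronecker, mulVec, dotProduct, of_apply, mul_comm]
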